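/- If [a, b], with a, b ∈ {1, …, n−1}, is the fluctuation interval of some fluctuation set, then [a, a+1] is a left wall and [b−1, b] is a right wall. -/

import Mathlib

/-- A finite well-mixed population with `m ≥ 1` types: type `i` consists of
`nvec i ≥ 1` identical agents with real payoff entries `R i, S i, T i, P i`. -/
structure Pop (m : ℕ) where
  hm : 0 < m
  nvec : Fin m → ℕ
  hnvec : ∀ i, 1 ≤ nvec i
  R : Fin m → ℝ
  S : Fin m → ℝ
  T : Fin m → ℝ
  P : Fin m → ℝ

variable {m : ℕ}

/-- The total number `n` of agents. -/
def nTot (pop : Pop m) : ℕ := ∑ i, pop.nvec i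

/-- Cooperative line of type `i`:  `u_i^C(k) = (R_i - S_i)·k + S_i·n`. -/
noncomputable def uC (pop : Pop m) (i : Fin m) (k : ℝ) : ℝ :=
  (pop.R i - pop.S i) * k + pop.S i * (nTot pop : ℝ)

/-- Defective line of type `i`:  `u_i^D(k) = (T_i - P_i)·k + P_i·n`. -/
noncomputable def uD (pop : Pop m) (i : Fin m) (k : ℝ) : ℝ :=
  (pop.T i - pop.P i) * k + pop.P i * (nTot pop : ℝ)

/-- A state: `x i` cooperators of type `i`, with `x i ≤ nvec i`. -/
def IsState (pop : Pop m) (x : Fin m → ℕ) : Prop := ∀ i, x i ≤ pop.nvec i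

/-- The total number of cooperators at state `x`. -/
def nC (x : Fin m → ℕ) : ℕ := ∑ i, x i

/-- The cooperative line of type `i` is active at `x`. -/
def activeC (x : Fin m → ℕ) (i : Fin m) : Prop := 0 < x i

/-- The defective line of type `i` is active at `x`. -/
def activeD (pop : Pop m) (x : Fin m → ℕ) (i : Fin m) : Prop := x i < pop.nvec i

/-- `v` bounds from above the values, at `k = nC x`, of all lines active at `x`;
the value of an active line satisfying this attains the maximum `M(x)`. -/
def ubActive (pop : Pop m) (x : Fin m → ℕ) (v : ℝ) : Prop :=
  (∀ i, activeC x i → uC pop i (nC x) ≤ v) ∧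
  (∀ i, activeD pop x i → uD pop i (nC x) ≤ v)

/-- Some active cooperative line attains the maximum `M(x)` over active lines. -/
def coopMax (pop : Pop m) (x : Fin m → ℕ) : Prop :=
  ∃ i, activeC x i ∧ ubActive pop x (uC pop i (nC x))

/-- Some active defective line attains the maximum `M(x)` over active lines. -/
def defMax (pop : Pop m) (x : Fin m → ℕ) : Prop :=
  ∃ i, activeD pop x i ∧ ubActive pop x (uD pop i (nC x))

/-- One-step successor relation of the asynchronous imitation dynamics: one agent
is activated; an activated cooperator of type `i` switches (to `x - e_i`) exactly
when no active cooperative line attains `M(x)`, an activated defector of type `i`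
switches (to `x + e_i`) exactly when no active defective line attains `M(x)`;
otherwise the state is unchanged. -/
def Step (pop : Pop m) (x y : Fin m → ℕ) : Prop :=
  (∃ i, activeC x i ∧
    ((coopMax pop x ∧ y = x) ∨
     (¬ coopMax pop x ∧ y = Function.update x i (x i - 1)))) ∨
  (∃ i, activeD pop x i ∧
    ((defMax pop x ∧ y = x) ∨
     (¬ defMax pop x ∧ y = Function.update x i (x i + 1))))

/-- A trajectory of the dynamics. -/
def Traj (pop : Pop m) (X : ℕ → Fin m → ℕ) : Prop :=
  IsState pop (X 0) ∧ ∀ t, Step pop (X t) (X (t + 1))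

/-- An equilibrium state: its only one-step successor is itself. -/
def IsEquilibrium (pop : Pop m) (x : Fin m → ℕ) : Prop :=
  IsState pop x ∧ ∀ y, Step pop x y → y = x

/-- A positively invariant set of states. -/
def PosInv (pop : Pop m) (Q : Set (Fin m → ℕ)) : Prop :=
  (∀ x ∈ Q, IsState pop x) ∧ ∀ x ∈ Q, ∀ y, Step pop x y → y ∈ Q

/-- A minimal positively invariant set: no nonempty proper subset is positively
invariant. -/
def MinPosInv (pop : Pop m) (Q : Set (Fin m → ℕ)) : Prop :=
  PosInv pop Q ∧ ∀ Q' : Set (Fin m → ℕ), Q' ⊂ Q → Q'.Nonempty → ¬ PosInv pop Q'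

/-- A fluctuation set: a minimal positively invariant set with more than one state. -/
def FluctSet (pop : Pop m) (O : Set (Fin m → ℕ)) : Prop :=
  MinPosInv pop O ∧ ∃ x ∈ O, ∃ y ∈ O, x ≠ y

/-- `[a, b]` is the fluctuation interval of the fluctuation set `O`:
`a = min {nC x : x ∈ O}` and `b = max {nC x : x ∈ O}`. -/
def FluctInterval (pop : Pop m) (O : Set (Fin m → ℕ)) (a b : ℕ) : Prop :=
  FluctSet pop O ∧
  (∃ x ∈ O, nC x = a) ∧ (∀ x ∈ O, a ≤ nC x) ∧
  (∃ x ∈ O, nC x = b) ∧ (∀ x ∈ O, nC x ≤ b)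

/-- An intersection point of `u_i^C` and `u_j^D`: a value `k ∈ [1, n-1]` with
`u_i^C(k) = u_j^D(k)`. -/
def IsInterPt (pop : Pop m) (i j : Fin m) (k : ℝ) : Prop :=
  1 ≤ k ∧ k ≤ (nTot pop : ℝ) - 1 ∧ uC pop i k = uD pop j k

/-- Potentially attracting: `u_i^C(k - 1) > u_j^D(k - 1)`. -/
def PotAttract (pop : Pop m) (i j : Fin m) (k : ℝ) : Prop :=
  uD pop j (k - 1) < uC pop i (k - 1)

/-- A fluctuation point: a non-integer potentially attracting intersection point
`p_ij` with value `k` such that there are a state `x` with `nC x = ⌊k⌋` at which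
`u_i^C` is active and attains the maximum among the lines active at `x`, and a
state obtained from `x` by increasing exactly one coordinate by `1` at which
`u_j^D` is active and attains the maximum among the active lines. -/
def IsFluctPt (pop : Pop m) (i j : Fin m) (k : ℝ) : Prop :=
  IsInterPt pop i j k ∧ PotAttract pop i j k ∧ (∀ z : ℤ, (z : ℝ) ≠ k) ∧
  ∃ x, IsState pop x ∧ ((nC x : ℤ) = ⌊k⌋) ∧
    activeC x i ∧ ubActive pop x (uC pop i (nC x)) ∧
    ∃ l, IsState pop (Function.update x l (x l + 1)) ∧
      activeD pop (Function.update x l (x l + 1)) j ∧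
      ubActive pop (Function.update x l (x l + 1))
        (uD pop j (nC (Function.update x l (x l + 1))))

/-- `[lo, hi]` contains the value of a fluctuation point. -/
def HasFluctPtIn (pop : Pop m) (lo hi : ℝ) : Prop :=
  ∃ i j : Fin m, ∃ k : ℝ, IsFluctPt pop i j k ∧ lo ≤ k ∧ k ≤ hi

/-- `[a, a+1]` is a left wall: every trajectory starting with at least `a + 1`
cooperators always has at least `a` cooperators. -/
def LeftWall (pop : Pop m) (a : ℕ) : Prop :=
  ∀ X : ℕ → Fin m → ℕ, Traj pop X → a + 1 ≤ nC (X 0) → ∀ t, a ≤ nC (X t)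

/-- `[b-1, b]` is a right wall: every trajectory starting with at most `b - 1`
cooperators always has at most `b` cooperators. -/
def RightWall (pop : Pop m) (b : ℕ) : Prop :=
  ∀ X : ℕ → Fin m → ℕ, Traj pop X → nC (X 0) ≤ b - 1 → ∀ t, nC (X t) ≤ b

/-- The 1-norm distance between two states. -/
def dist1 (x y : Fin m → ℕ) : ℕ := ∑ i, ((x i : ℤ) - (y i : ℤ)).natAbs

/-- Lyapunov stability of an equilibrium state `s`. -/
def Stable (pop : Pop m) (s : Fin m → ℕ) : Prop :=
  ∀ ε : ℕ, 2 ≤ ε → ∃ δ : ℕ, 2 ≤ δ ∧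
    ∀ X : ℕ → Fin m → ℕ, Traj pop X → dist1 (X 0) s < δ → ∀ t, dist1 (X t) s < ε

lemma aux_pred (x : Fin m → ℕ) (i : Fin m) (h : 0 < x i) :
    nC (Function.update x i (x i - 1)) + 1 = nC x := by
  unfold nC
  rw [Finset.sum_update_of_mem (Finset.mem_univ i), ← Finset.add_sum_erase _ x (Finset.mem_univ i),
    Finset.sdiff_singleton_eq_erase]
  omega

lemma aux_succ (x : Fin m → ℕ) (i : Fin m) :
    nC (Function.update x i (x i + 1)) = nC x + 1 := by
  unfold nC
  rw [Finset.sum_update_of_mem (Finset.mem_univ i), ← Finset.add_sum_erase _ x (Finset.mem_univ i),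
    Finset.sdiff_singleton_eq_erase]
  omega

lemma aux_sum_swap (w : Fin m → ℕ) (i j : Fin m) (hij : i ≠ j) (h : 0 < w i) :
    ∑ k, Function.update (Function.update w i (w i - 1)) j (w j + 1) k = ∑ k, w k := by
  have h1 := aux_pred w i h
  have h2 := aux_succ (Function.update w i (w i - 1)) j
  rw [Function.update_of_ne hij.symm] at h2
  unfold nC at h1 h2
  omega

lemma aux_swapL (n y : Fin m → ℕ) (F G : Fin m → ℝ) (O : Set (Fin m → ℕ))
    (hy : ∀ i, y i ≤ n i) (d' : Fin m) (hd' : y d' < n d')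
    (hF : ∀ j, 0 < y j → F j < G d') (hO : ∀ w ∈ O, ∀ i, w i ≤ n i)
    (hsw : ∀ w ∈ O, ∑ k, w k = ∑ k, y k →
      (∃ d, w d < n d ∧ ∀ j, 0 < w j → F j < G d) → ∀ i j, i ≠ j → 0 < w i → w j < n j →
      Function.update (Function.update w i (w i - 1)) j (w j + 1) ∈ O) :
    ∀ N, ∀ w ∈ O, ∑ k, w k = ∑ k, y k → (∃ d, w d < n d ∧ ∀ j, 0 < w j → F j < G d) →
      ∑ k, (w k - y k) ≤ N → y ∈ O := by
  intro N
  induction N with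
  | zero =>
    intro w hw hs _ hN
    have h0 : ∀ k, w k ≤ y k := by
      intro k
      have := Finset.single_le_sum (f := fun k => w k - y k) (fun _ _ => Nat.zero_le _) (Finset.mem_univ k)
      omega
    have := (Finset.sum_eq_sum_iff_of_le (fun k _ => h0 k)).1 hs
    have hwy : w = y := funext fun k => this k (Finset.mem_univ k)
    rwa [← hwy]
  | succ N ih =>
    intro w hw hs hdef hN
    by_cases hwy : w = y
    · rwa [← hwy]
    have hex : ∃ i, y i < w i := by
      by_contra! h
      have := (Finset.sum_eq_sum_iff_of_le (fun k _ => h k)).1 hs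
      exact hwy (funext fun k => this k (Finset.mem_univ k))
    have hde : ∃ j, w j < y j := by
      by_contra! h
      have := (Finset.sum_eq_sum_iff_of_le (fun k _ => h k)).1 hs.symm
      exact hwy (funext fun k => (this k (Finset.mem_univ k)).symm)
    have key : ∀ i j, y i < w i → w j < y j →
        ((∃ d, (Function.update (Function.update w i (w i - 1)) j (w j + 1)) d < n d ∧
          ∀ k, 0 < (Function.update (Function.update w i (w i - 1)) j (w j + 1)) k → F k < G d) ∨
          Function.update (Function.update w i (w i - 1)) j (w j + 1) = y) → y ∈ O := by
      intro i j hi hj h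
      have hij : i ≠ j := by rintro rfl; omega
      have hmem := hsw w hw hs hdef i j hij (by omega) (lt_of_lt_of_le hj (hy j))
      have hsum := aux_sum_swap w i j hij (by omega)
      have hv : ∀ k, Function.update (Function.update w i (w i - 1)) j (w j + 1) k =
          if k = j then w j + 1 else if k = i then w i - 1 else w k := by
        intro k; simp [Function.update_apply]
      rcases h with h | h
      · refine ih _ hmem (hsum.trans hs) h ?_
        have : ∑ k, (Function.update (Function.update w i (w i - 1)) j (w j + 1) k - y k)
            < ∑ k, (w k - y k) := by
          apply Finset.sum_lt_sum
          · intro k _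
            rw [hv]
            split_ifs with h1 h2
            · subst h1; omega
            · subst h2; omega
            · exact le_rfl
          · refine ⟨i, Finset.mem_univ _, ?_⟩
            rw [hv, if_neg hij, if_pos rfl]; omega
        omega
      · rwa [h] at hmem
    have hv : ∀ i j k, Function.update (Function.update w i (w i - 1)) j (w j + 1) k =
        if k = j then w j + 1 else if k = i then w i - 1 else w k := by
      intro i j k; simp [Function.update_apply]
    obtain ⟨d, hd, hdF⟩ := hdef
    by_cases hG : G d ≤ G d'
    · have hF' : ∀ i j, w j < y j → ∀ k,
          0 < (Function.update (Function.update w i (w i - 1)) j (w j + 1)) k → F k < G d' := by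
        intro i j hj k hk
        rw [hv] at hk
        split_ifs at hk with h1 h2
        · subst h1; exact hF _ (by omega)
        · subst h2; exact lt_of_lt_of_le (hdF _ (by omega)) hG
        · exact lt_of_lt_of_le (hdF _ hk) hG
      obtain ⟨j, hj⟩ := hde
      by_cases hwd : y d' < w d'
      · refine key d' j hwd hj (Or.inl ⟨d', ?_, hF' _ _ hj⟩)
        have := hO w hw d'
        rw [hv, if_neg (by rintro rfl; omega), if_pos rfl]; omega
      · obtain ⟨i, hi⟩ := hex
        refine key i j hi hj (Or.inl ⟨d', ?_, hF' _ _ hj⟩)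
        rw [hv]
        split_ifs with h1 h2
        · subst h1; omega
        · subst h2; omega
        · omega
    · push Not at hG
      obtain ⟨i, hi⟩ := hex
      have hF' : ∀ i j, w j < y j → ∀ k,
          0 < (Function.update (Function.update w i (w i - 1)) j (w j + 1)) k → F k < G d := by
        intro i j hj k hk
        rw [hv] at hk
        split_ifs at hk with h1 h2
        · subst h1; exact (hF _ (by omega)).trans hG
        · subst h2; exact hdF _ (by omega)
        · exact hdF _ hk
      by_cases hj : ∃ j, w j < y j ∧ j ≠ d
      · obtain ⟨j, hj, hjd⟩ := hj
        refine key i j hi hj (Or.inl ⟨d, ?_, hF' _ _ hj⟩)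
        rw [hv, if_neg hjd.symm]
        split_ifs with h2
        · subst h2; omega
        · exact hd
      · push Not at hj
        obtain ⟨j, hjj⟩ := hde
        have hjd := hj j hjj
        subst hjd
        by_cases hlt : w j + 1 < n j
        · refine key i j hi hjj (Or.inl ⟨j, ?_, hF' _ _ hjj⟩)
          rw [hv, if_pos rfl]; exact hlt
        · refine key i j hi hjj (Or.inr ?_)
          have hij : i ≠ j := by rintro rfl; omega
          have hsum := aux_sum_swap w i j hij (by omega)
          have hge : ∀ k, y k ≤ Function.update (Function.update w i (w i - 1)) j (w j + 1) k := by
            intro k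
            rw [hv]
            split_ifs with h1 h2
            · subst h1; have := hy k; omega
            · subst h2; omega
            · by_contra! h
              exact h1 (hj k h)
          have := (Finset.sum_eq_sum_iff_of_le (fun k _ => hge k)).1 (hsum.trans hs).symm
          exact funext fun k => (this k (Finset.mem_univ k)).symm

lemma aux_swapR (n y : Fin m → ℕ) (F G : Fin m → ℝ) (O : Set (Fin m → ℕ))
    (hy : ∀ i, y i ≤ n i) (d' : Fin m) (hd' : 0 < y d')
    (hF : ∀ j, y j < n j → F j < G d') (hO : ∀ w ∈ O, ∀ i, w i ≤ n i)
    (hsw : ∀ w ∈ O, ∑ k, w k = ∑ k, y k →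
      (∃ d, 0 < w d ∧ ∀ j, w j < n j → F j < G d) → ∀ i j, i ≠ j → 0 < w i → w j < n j →
      Function.update (Function.update w i (w i - 1)) j (w j + 1) ∈ O)
    (w : Fin m → ℕ) (hw : w ∈ O) (hs : ∑ k, w k = ∑ k, y k)
    (hdef : ∃ d, 0 < w d ∧ ∀ j, w j < n j → F j < G d) : y ∈ O := by
  have hsub : ∀ u : Fin m → ℕ, (∀ i, u i ≤ n i) → ∑ k, (n k - u k) + ∑ k, u k = ∑ k, n k := by
    intro u hu
    rw [← Finset.sum_add_distrib]
    exact Finset.sum_congr rfl fun k _ => Nat.sub_add_cancel (hu k)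
  have hcc : ∀ u : Fin m → ℕ, (∀ i, u i ≤ n i) → (fun k => n k - (n k - u k)) = u := by
    intro u hu
    funext k
    have := hu k
    omega
  have h1 := hsub w (hO w hw)
  have h2 := hsub y hy
  have := aux_swapL n (fun k => n k - y k) F G
    {u | (∀ i, u i ≤ n i) ∧ (fun k => n k - u k) ∈ O} (fun i => Nat.sub_le _ _) d'
    (by have := hy d'; show n d' - y d' < n d'; omega) (fun j hj => hF j (by
      have hj : 0 < n j - y j := hj
      omega)) (fun u hu => hu.1) ?_ _ (fun k => n k - w k)
      ⟨fun i => Nat.sub_le _ _, by rw [hcc w (hO w hw)]; exact hw⟩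
      (by show ∑ k, (n k - w k) = ∑ k, (n k - y k); omega) ?_ le_rfl
  · have h := this.2
    rwa [hcc y hy] at h
  · rintro u ⟨hu, huO⟩ hsu ⟨d, hd, hdF⟩ i j hij hi hj
    have h3 := hsub u hu
    have h4 := hsw _ huO (by
      have hsu : ∑ k, u k = ∑ k, (n k - y k) := hsu
      omega) ⟨d, by show 0 < n d - u d; omega, fun k hk => hdF k (by
        have hk : n k - u k < n k := hk
        omega)⟩ j i hij.symm (by show 0 < n j - u j; omega)
        (by have := hu i; show n i - u i < n i; omega)
    refine ⟨?_, ?_⟩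
    · intro k
      have := hu k
      simp only [Function.update_apply]
      split_ifs with h5 h6
      · subst h5; omega
      · subst h6; omega
      · omega
    · convert h4 using 1
      funext k
      have := hu k
      simp only [Function.update_apply]
      split_ifs with h5 h6 h7 <;> subst_vars <;> omega
  · obtain ⟨d, hd, hdF⟩ := hdef
    refine ⟨d, ?_, fun j hj => hdF j ?_⟩
    · have := hO w hw d
      show n d - w d < n d
      omega
    · have hj : 0 < n j - w j := hj
      omega

lemma aux_max (pop : Pop m) (x : Fin m → ℕ) :
    (∃ i, activeC x i ∧ ubActive pop x (uC pop i (nC x))) ∨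
    (∃ i, activeD pop x i ∧ ubActive pop x (uD pop i (nC x))) := by
  classical
  let f : Fin m ⊕ Fin m → ℝ := Sum.elim (fun i => uC pop i (nC x)) (fun i => uD pop i (nC x))
  let A : Fin m ⊕ Fin m → Prop := Sum.elim (fun i => activeC x i) (fun i => activeD pop x i)
  have hne : (Finset.univ.filter A).Nonempty := by
    have h1 := pop.hnvec ⟨0, pop.hm⟩
    by_cases h : 0 < x ⟨0, pop.hm⟩
    · exact ⟨Sum.inl ⟨0, pop.hm⟩, Finset.mem_filter.2 ⟨Finset.mem_univ _, h⟩⟩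
    · refine ⟨Sum.inr ⟨0, pop.hm⟩, ?_⟩
      refine Finset.mem_filter.2 ⟨Finset.mem_univ _, ?_⟩
      show x ⟨0, pop.hm⟩ < pop.nvec ⟨0, pop.hm⟩
      omega
  obtain ⟨p, hp, hmax⟩ := Finset.exists_max_image _ f hne
  have hub : ubActive pop x (f p) :=
    ⟨fun i hi => hmax (Sum.inl i) (Finset.mem_filter.2 ⟨Finset.mem_univ _, hi⟩),
     fun i hi => hmax (Sum.inr i) (Finset.mem_filter.2 ⟨Finset.mem_univ _, hi⟩)⟩
  rcases p with i | i
  · exact Or.inl ⟨i, (Finset.mem_filter.1 hp).2, hub⟩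
  · exact Or.inr ⟨i, (Finset.mem_filter.1 hp).2, hub⟩

lemma aux_domD (pop : Pop m) (x : Fin m → ℕ) : ¬ coopMax pop x ↔
    ∃ d, x d < pop.nvec d ∧ ∀ j, 0 < x j → uC pop j (nC x) < uD pop d (nC x) := by
  constructor
  · intro h
    rcases aux_max pop x with h' | ⟨d, hd, hub⟩
    · exact absurd h' h
    · refine ⟨d, hd, fun j hj => lt_of_le_of_ne (hub.1 j hj) fun he => h ⟨j, hj, ?_⟩⟩
      rw [he]; exact hub
  · rintro ⟨d, hd, hF⟩ ⟨j, hj, hub⟩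
    exact absurd (hub.2 d hd) (not_le.2 (hF j hj))

lemma aux_domC (pop : Pop m) (x : Fin m → ℕ) : ¬ defMax pop x ↔
    ∃ d, 0 < x d ∧ ∀ j, x j < pop.nvec j → uD pop j (nC x) < uC pop d (nC x) := by
  constructor
  · intro h
    rcases aux_max pop x with ⟨d, hd, hub⟩ | h'
    · refine ⟨d, hd, fun j hj => lt_of_le_of_ne (hub.2 j hj) fun he => h ⟨j, hj, ?_⟩⟩
      rw [he]; exact hub
    · exact absurd h' h
  · rintro ⟨d, hd, hF⟩ ⟨j, hj, hub⟩
    exact absurd (hub.1 d hd) (not_le.2 (hF j hj))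

lemma aux_state (pop : Pop m) (x y : Fin m → ℕ) (hx : IsState pop x) (h : Step pop x y) :
    IsState pop y := by
  rcases h with ⟨i, hi, ⟨_, rfl⟩ | ⟨_, rfl⟩⟩ | ⟨i, hi, ⟨_, rfl⟩ | ⟨_, rfl⟩⟩
  · exact hx
  · intro k
    have := hx k
    rw [Function.update_apply]
    split_ifs with h
    · subst h; omega
    · exact this
  · exact hx
  · intro k
    have := hx k
    unfold activeD at hi
    rw [Function.update_apply]
    split_ifs with h
    · subst h; omega
    · exact this

lemma aux_noeq (pop : Pop m) (O : Set (Fin m → ℕ)) (hO : FluctSet pop O) (x : Fin m → ℕ)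
    (hx : x ∈ O) (hc : coopMax pop x) (hd : defMax pop x) : False := by
  obtain ⟨⟨⟨hst, hinv⟩, hmin⟩, u, hu, v, hv, huv⟩ := hO
  refine hmin {x} ⟨by simpa using hx, fun h => huv ?_⟩ ⟨x, rfl⟩ ⟨?_, ?_⟩
  · rw [show u = x from h hu, show v = x from h hv]
  · rintro _ rfl; exact hst _ hx
  · rintro _ rfl y hy
    rcases hy with ⟨i, hi, ⟨_, rfl⟩ | ⟨h, rfl⟩⟩ | ⟨i, hi, ⟨_, rfl⟩ | ⟨h, rfl⟩⟩
    · rfl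
    · exact absurd hc h
    · rfl
    · exact absurd hd h

lemma aux_exC (x : Fin m → ℕ) (h : 1 ≤ nC x) : ∃ i, 0 < x i := by
  by_contra! h'
  have : nC x = 0 := Finset.sum_eq_zero fun i _ => Nat.le_zero.1 (h' i)
  omega

lemma aux_exD (pop : Pop m) (x : Fin m → ℕ) (h : nC x < nTot pop) :
    ∃ i, x i < pop.nvec i := by
  by_contra! h'
  have : nTot pop ≤ nC x := Finset.sum_le_sum fun i _ => h' i
  omega

lemma aux_left (pop : Pop m) (O : Set (Fin m → ℕ)) (a : ℕ)
    (ha : 1 ≤ a) (ha' : a < nTot pop) (hO : FluctSet pop O)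
    (hx : ∃ x ∈ O, nC x = a) (hmin : ∀ x ∈ O, a ≤ nC x) : LeftWall pop a := by
  have hnd : ∀ x ∈ O, nC x = a → ¬ defMax pop x := by
    intro x hxO hxa hd
    have hc : ¬ coopMax pop x := fun hc => aux_noeq pop O hO x hxO hc hd
    obtain ⟨i, hi⟩ := aux_exC x (by omega)
    have := hmin _ (hO.1.1.2 x hxO _ (Or.inl ⟨i, hi, Or.inr ⟨hc, rfl⟩⟩))
    have := aux_pred x i hi
    omega
  obtain ⟨x, hxO, hxa⟩ := hx
  have hw : ∃ w ∈ O, nC w = a + 1 ∧ ¬ coopMax pop w := by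
    by_contra! hcon
    refine hO.1.2 {z | z ∈ O ∧ a + 1 ≤ nC z} ⟨fun z hz => hz.1, fun h => ?_⟩ ?_ ⟨?_, ?_⟩
    · have := (h hxO).2
      omega
    · obtain ⟨i, hi⟩ := aux_exD pop x (by omega)
      refine ⟨_, hO.1.1.2 x hxO _ (Or.inr ⟨i, hi, Or.inr ⟨hnd x hxO hxa, rfl⟩⟩), ?_⟩
      rw [aux_succ]; omega
    · exact fun z hz => hO.1.1.1 z hz.1
    · rintro z ⟨hzO, hz⟩ u hu
      refine ⟨hO.1.1.2 z hzO u hu, ?_⟩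
      rcases hu with ⟨i, hi, ⟨_, rfl⟩ | ⟨h, rfl⟩⟩ | ⟨i, hi, ⟨_, rfl⟩ | ⟨h, rfl⟩⟩
      · exact hz
      · have := aux_pred z i hi
        have : nC z ≠ a + 1 := fun he => h (hcon z hzO he)
        omega
      · exact hz
      · rw [aux_succ]; omega
  obtain ⟨w, hwO, hwa, hwc⟩ := hw
  have key : ∀ y, IsState pop y → nC y = a + 1 → ¬ coopMax pop y → y ∈ O := by
    intro y hy hya hyc
    obtain ⟨d', hd', hF⟩ := (aux_domD pop y).1 hyc
    refine aux_swapL pop.nvec y (fun j => uC pop j ((a + 1 : ℕ) : ℝ))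
      (fun j => uD pop j ((a + 1 : ℕ) : ℝ)) O hy d' hd' (by rw [hya] at hF; exact hF)
      hO.1.1.1 ?_ _ w hwO (hwa.trans hya.symm) ?_ le_rfl
    · intro v hv hsv hdv i j hij hi hj
      have hva : nC v = a + 1 := Eq.trans hsv hya
      have hvc : ¬ coopMax pop v := (aux_domD pop v).2 (by rw [hva]; exact hdv)
      have h1 := hO.1.1.2 v hv _ (Or.inl ⟨i, hi, Or.inr ⟨hvc, rfl⟩⟩)
      have h2 := aux_pred v i hi
      have h3 := hO.1.1.2 _ h1 _ (Or.inr ⟨j, by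
        unfold activeD
        rw [Function.update_of_ne hij.symm]; exact hj, Or.inr ⟨hnd _ h1 (by omega), rfl⟩⟩)
      rwa [Function.update_of_ne hij.symm] at h3
    · have := (aux_domD pop w).1 hwc
      rw [hwa] at this
      exact this
  intro X hX h0 t
  have inv : ∀ t, IsState pop (X t) ∧ (a + 1 ≤ nC (X t) ∨ X t ∈ O) := by
    intro t
    induction t with
    | zero => exact ⟨hX.1, Or.inl h0⟩
    | succ t ih =>
      obtain ⟨hs, h⟩ := ih
      have hst := hX.2 t
      refine ⟨aux_state pop _ _ hs hst, ?_⟩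
      by_cases hmem : X t ∈ O
      · exact Or.inr (hO.1.1.2 _ hmem _ hst)
      · have h := h.resolve_right hmem
        left
        rcases hst with ⟨i, hi, ⟨_, he⟩ | ⟨hc, he⟩⟩ | ⟨i, hi, ⟨_, he⟩ | ⟨hc, he⟩⟩
        · rw [he]; exact h
        · rw [he]
          have := aux_pred (X t) i hi
          have : nC (X t) ≠ a + 1 := fun h' => hmem (key _ hs h' hc)
          omega
        · rw [he]; exact h
        · rw [he, aux_succ]; omega
  rcases (inv t).2 with h | h
  · omega
  · exact hmin _ h

lemma aux_right (pop : Pop m) (O : Set (Fin m → ℕ)) (b : ℕ)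
    (hb : 1 ≤ b) (hb' : b < nTot pop) (hO : FluctSet pop O)
    (hx : ∃ x ∈ O, nC x = b) (hmax : ∀ x ∈ O, nC x ≤ b) : RightWall pop b := by
  have hnd : ∀ x ∈ O, nC x = b → ¬ coopMax pop x := by
    intro x hxO hxa hc
    have hd : ¬ defMax pop x := fun hd => aux_noeq pop O hO x hxO hc hd
    obtain ⟨i, hi⟩ := aux_exD pop x (by omega)
    have := hmax _ (hO.1.1.2 x hxO _ (Or.inr ⟨i, hi, Or.inr ⟨hd, rfl⟩⟩))
    have := aux_succ x i
    omega
  obtain ⟨x, hxO, hxa⟩ := hx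
  have hw : ∃ w ∈ O, nC w + 1 = b ∧ ¬ defMax pop w := by
    by_contra! hcon
    refine hO.1.2 {z | z ∈ O ∧ nC z + 1 ≤ b} ⟨fun z hz => hz.1, fun h => ?_⟩ ?_ ⟨?_, ?_⟩
    · have := (h hxO).2
      omega
    · obtain ⟨i, hi⟩ := aux_exC x (by omega)
      refine ⟨_, hO.1.1.2 x hxO _ (Or.inl ⟨i, hi, Or.inr ⟨hnd x hxO hxa, rfl⟩⟩), ?_⟩
      rw [aux_pred x i hi]; omega
    · exact fun z hz => hO.1.1.1 z hz.1
    · rintro z ⟨hzO, hz⟩ u hu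
      refine ⟨hO.1.1.2 z hzO u hu, ?_⟩
      rcases hu with ⟨i, hi, ⟨_, rfl⟩ | ⟨h, rfl⟩⟩ | ⟨i, hi, ⟨_, rfl⟩ | ⟨h, rfl⟩⟩
      · exact hz
      · rw [aux_pred z i hi]; omega
      · exact hz
      · have : nC z + 1 ≠ b := fun he => h (hcon z hzO he)
        rw [aux_succ]; omega
  obtain ⟨w, hwO, hwa, hwc⟩ := hw
  have key : ∀ y, IsState pop y → nC y + 1 = b → ¬ defMax pop y → y ∈ O := by
    intro y hy hya hyc
    obtain ⟨d', hd', hF⟩ := (aux_domC pop y).1 hyc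
    have hwy : nC w = nC y := by omega
    refine aux_swapR pop.nvec y (fun j => uD pop j (nC y : ℝ))
      (fun j => uC pop j (nC y : ℝ)) O hy d' hd' hF hO.1.1.1 ?_ w hwO hwy ?_
    · intro v hv hsv hdv i j hij hi hj
      have hva : nC v = nC y := hsv
      have hvc : ¬ defMax pop v := (aux_domC pop v).2 (by rw [hva]; exact hdv)
      have h1 := hO.1.1.2 v hv _ (Or.inr ⟨j, hj, Or.inr ⟨hvc, rfl⟩⟩)
      have h2 := aux_succ v j
      have h3 := hO.1.1.2 _ h1 _ (Or.inl ⟨i, by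
        unfold activeC
        rw [Function.update_of_ne hij]; exact hi, Or.inr ⟨hnd _ h1 (by omega), rfl⟩⟩)
      rw [Function.update_of_ne hij] at h3
      rwa [Function.update_comm hij]
    · have := (aux_domC pop w).1 hwc
      rw [hwy] at this
      exact this
  intro X hX h0 t
  have inv : ∀ t, IsState pop (X t) ∧ (nC (X t) + 1 ≤ b ∨ X t ∈ O) := by
    intro t
    induction t with
    | zero => exact ⟨hX.1, Or.inl (by omega)⟩
    | succ t ih =>
      obtain ⟨hs, h⟩ := ih
      have hst := hX.2 t
      refine ⟨aux_state pop _ _ hs hst, ?_⟩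
      by_cases hmem : X t ∈ O
      · exact Or.inr (hO.1.1.2 _ hmem _ hst)
      · have h := h.resolve_right hmem
        left
        rcases hst with ⟨i, hi, ⟨_, he⟩ | ⟨hc, he⟩⟩ | ⟨i, hi, ⟨_, he⟩ | ⟨hc, he⟩⟩
        · rw [he]; exact h
        · rw [he, aux_pred (X t) i hi]; omega
        · rw [he]; exact h
        · have : nC (X t) + 1 ≠ b := fun h' => hmem (key _ hs h' hc)
          rw [he, aux_succ]; omega
  rcases (inv t).2 with h | h
  · omega
  · exact hmax _ h

/-- the end intervals of a fluctuation interval are a left wall and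
a right wall, respectively. -/
theorem stmt6 (pop : Pop m) (O : Set (Fin m → ℕ)) (a b : ℕ)
    (ha : 1 ≤ a) (ha' : a ≤ nTot pop - 1) (hb : 1 ≤ b) (hb' : b ≤ nTot pop - 1)
    (hO : FluctInterval pop O a b) :
    LeftWall pop a ∧ RightWall pop b := by
  obtain ⟨hF, h1, h2, h3, h4⟩ := hO
  exact ⟨aux_left pop O a ha (by omega) hF h1 h2, aux_right pop O b hb (by omega) hF h3 h4⟩
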